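/- arXiv:2311.08406 — 6 statements merged into one kernel-verified Lean document; each statement's English description precedes it below -/
import Mathlib

section
/- Let (L,[.,.],α) be a regular multiplicative Hom-Lie algebra over a field F of prime characteristic p equipped with a p-structure [p]. Then the α^{p-1}-center C(L) is a p-ideal of the restricted Hom-Lie algebra (L,[.,.],α,[p]), i.e., C(L) is a subspace with α(C(L)) ⊆ C(L), [C(L),L] ⊆ C(L), and x^[p] ∈ C(L) for all x ∈ C(L). -/
namespace HomLiePaper

/-- The axioms of a Hom-Lie algebra over a field `F`: the bracket is bilinear and
skew-symmetric, the twist `α` is linear, and the Hom-Jacobi identity holds. -/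
structure IsHomLie (F : Type*) {L : Type*} [Field F] [AddCommGroup L] [Module F L]
    (br : L → L → L) (α : L → L) : Prop where
  add_left : ∀ x y z : L, br (x + y) z = br x z + br y z
  smul_left : ∀ (k : F) (x y : L), br (k • x) y = k • br x y
  add_right : ∀ x y z : L, br x (y + z) = br x y + br x z
  smul_right : ∀ (k : F) (x y : L), br x (k • y) = k • br x y
  skew : ∀ x y : L, br x y = - br y x
  alpha_linear : IsLinearMap F α
  jacobi : ∀ x y z : L, br (α x) (br y z) + br (α y) (br z x) + br (α z) (br x y) = 0

/-- Multiplicativity of the twist `α`. -/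
def IsMult {L : Type*} (br : L → L → L) (α : L → L) : Prop :=
  ∀ x y : L, α (br x y) = br (α x) (α y)

/-- `adPow br α x n = ad(α^[n-1] x) ∘ ad(α^[n-2] x) ∘ ⋯ ∘ ad(x)` (with `n` factors). -/
def adPow {L : Type*} (br : L → L → L) (α : L → L) (x : L) : ℕ → L → L
  | 0 => fun z => z
  | n + 1 => fun z => br (α^[n] x) (adPow br α x n z)

/-- `pm` is a `p`-structure on the Hom-Lie (sub)algebra carried by the subset `S` of `L`
(for the whole algebra take `S = Set.univ`): `pm` maps `S` into itself and satisfies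
(R1) `ad(x^[p]) ∘ α^(p-1) = ad(α^(p-1) x) ∘ ⋯ ∘ ad(x)` on `S`,
(R2) `(k • x)^[p] = k^p • x^[p]`, and
(R3) `(x+y)^[p] = x^[p] + y^[p] + ∑_{i=1}^{p-1} s_i(x,y)` where the `s_i(x,y)` are
determined by `ad(α^(p-2)(k•x+y)) ∘ ⋯ ∘ ad(k•x+y) (x) = ∑_{i=1}^{p-1} i k^(i-1) • s_i(x,y)`
for all `k : F`. -/
def IsPStructureOn (F : Type*) {L : Type*} [Field F] [AddCommGroup L] [Module F L]
    (p : ℕ) (br : L → L → L) (α : L → L) (S : Set L) (pm : L → L) : Prop :=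
  (∀ x ∈ S, pm x ∈ S) ∧
  (∀ x ∈ S, ∀ y ∈ S, br (pm x) (α^[p - 1] y) = adPow br α x p y) ∧
  (∀ x ∈ S, ∀ k : F, pm (k • x) = k ^ p • pm x) ∧
  (∀ x ∈ S, ∀ y ∈ S, ∃ s : ℕ → L,
    (∀ i ∈ Finset.Icc 1 (p - 1), s i ∈ S) ∧
    (∀ k : F, adPow br α (k • x + y) (p - 1) x
        = ∑ i ∈ Finset.Icc 1 (p - 1), ((i : F) * k ^ (i - 1)) • s i) ∧
    pm (x + y) = pm x + pm y + ∑ i ∈ Finset.Icc 1 (p - 1), s i)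

/-- The Hom-Lie (sub)algebra carried by `S ⊆ L` is restrictable: for every `x ∈ S` there is
`y ∈ S` with `ad(α^(p-1) x) ∘ ⋯ ∘ ad(x) = ad(y) ∘ α^(p-1)` as operators on `S`. -/
def RestrictableOn {L : Type*} (p : ℕ) (br : L → L → L) (α : L → L) (S : Set L) : Prop :=
  ∀ x ∈ S, ∃ y ∈ S, ∀ z ∈ S, adPow br α x p z = br y (α^[p - 1] z)

/-- For a regular multiplicative Hom-Lie algebra `(L, br, α)` over a field of prime
characteristic `p` with a `p`-structure `pm`, the `α^(p-1)`-center
`C(L) = {x | [x, α^(p-1) y] = 0 for all y}` is a `p`-ideal: it is a subspace, closed under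
`α`, absorbs brackets with all of `L`, and is closed under the `p`-structure. -/
theorem center_is_p_ideal {F L : Type*} [Field F] [AddCommGroup L] [Module F L]
    (p : ℕ) (hp : p.Prime) [CharP F p]
    (br : L → L → L) (α : L → L) (pm : L → L)
    (hHL : IsHomLie F br α) (hM : IsMult br α) (hreg : Function.Bijective α)
    (hps : IsPStructureOn F p br α Set.univ pm) :
    let C : Set L := {x : L | ∀ y : L, br x (α^[p - 1] y) = 0}
    (0 : L) ∈ C ∧ (∀ x ∈ C, ∀ y ∈ C, x + y ∈ C) ∧ (∀ (k : F), ∀ x ∈ C, k • x ∈ C) ∧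
    (∀ x ∈ C, α x ∈ C) ∧ (∀ x ∈ C, ∀ y : L, br x y ∈ C) ∧ (∀ x ∈ C, pm x ∈ C) := by
  intro C
  have hsurj : Function.Surjective α^[p - 1] := hreg.surjective.iterate _
  have central : ∀ x : L, x ∈ C ↔ ∀ y : L, br x y = 0 := fun x =>
    ⟨fun h y => by obtain ⟨z, rfl⟩ := hsurj y; exact h z, fun h y => h _⟩
  have zero_left : ∀ y : L, br 0 y = 0 := fun y => by
    simpa using hHL.smul_left 0 0 y
  have alpha_mem : ∀ x ∈ C, α x ∈ C := by
    intro x hx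
    rw [central] at hx ⊢
    intro y
    obtain ⟨z, rfl⟩ := hreg.surjective y
    rw [← hM, hx, hHL.alpha_linear.map_zero]
  have iterate_mem : ∀ n : ℕ, ∀ x ∈ C, α^[n] x ∈ C := by
    intro n
    induction n with
    | zero => exact fun x hx => hx
    | succ n ih => exact fun x hx => ih _ (alpha_mem x hx)
  refine ⟨fun y => zero_left _, fun x hx y hy z => ?_, fun k x hx y => ?_, alpha_mem,
    fun x hx y z => ?_, fun x hx y => ?_⟩
  · rw [hHL.add_left, hx, hy, add_zero]
  · rw [hHL.smul_left, hx, smul_zero]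
  · rw [(central x).1 hx y, zero_left]
  · rw [hps.2.1 x trivial y trivial]
    obtain ⟨n, rfl⟩ := Nat.exists_eq_succ_of_ne_zero hp.ne_zero
    exact (central _).1 (iterate_mem n x hx) _
end HomLiePaper
end

section
/- Let (g,[.,.]_g,α,[p]) be a restricted Hom-Lie algebra over a field F of prime characteristic p, let L ⊆ g be a Hom-Lie subalgebra, and let [p]¹ : L → L be a map. Then the following are equivalent: (1) [p]¹ is a p-structure on the multiplicative Hom-Lie algebra (L,[.,.]_g,α|_L); (2) there exists a p-semilinear map f : L → C_g(L) such that x^{[p]¹} = x^[p] + f(x) for all x ∈ L. -/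
namespace HomLiePaper

/-- A vector-valued polynomial function `k ↦ ∑ i k^(i-1) • s i` of degree less than `p - 1`
vanishing on a field of characteristic `p` has only zero coefficients. -/
theorem coeff_eq_zero_of_forall_sum_eq_zero {F M : Type*} [Field F] [AddCommGroup M] [Module F M]
    {p : ℕ} (hp : p.Prime) [CharP F p] {s : ℕ → M}
    (h : ∀ k : F, ∑ i ∈ Finset.Icc 1 (p - 1), ((i : F) * k ^ (i - 1)) • s i = 0) :
    ∀ i ∈ Finset.Icc 1 (p - 1), s i = 0 := by
  intro j hj
  rw [← Module.forall_dual_apply_eq_zero_iff F]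
  intro φ
  let q : Polynomial F :=
    ∑ i ∈ Finset.Icc 1 (p - 1), Polynomial.C ((i : F) * φ (s i)) * Polynomial.X ^ (i - 1)
  have hq : q = 0 := by
    refine Polynomial.eq_zero_of_natDegree_lt_card_of_eval_eq_zero q
      (f := fun n : Fin p => ((n : ℕ) : F)) ?_ ?_ ?_
    · intro a b hab
      exact Fin.ext (CharP.natCast_injOn_Iio F p a.2 b.2 hab)
    · intro n
      have := congrArg φ (h ((n : ℕ) : F))
      simp only [map_sum, map_smul, smul_eq_mul, map_zero] at this
      simp only [q, Polynomial.eval_finsetSum, Polynomial.eval_mul, Polynomial.eval_C,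
        Polynomial.eval_pow, Polynomial.eval_X]
      rw [← this]
      exact Finset.sum_congr rfl fun i _ => by ring
    · rw [Fintype.card_fin]
      refine lt_of_le_of_lt (Polynomial.natDegree_sum_le_of_forall_le (n := p - 1) _ _ ?_)
        (Nat.sub_lt hp.pos one_pos)
      intro i hi
      refine (Polynomial.natDegree_C_mul_X_pow_le _ _).trans ?_
      have := (Finset.mem_Icc.1 hi).2
      omega
  have hc := congrArg (fun r => Polynomial.coeff r (j - 1)) hq
  simp only [q, Polynomial.finsetSum_coeff, Polynomial.coeff_C_mul_X_pow,
    Polynomial.coeff_zero] at hc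
  rw [Finset.sum_eq_single_of_mem j hj] at hc
  · rw [if_pos rfl] at hc
    refine (mul_eq_zero.1 hc).resolve_left fun h0 => ?_
    rw [CharP.cast_eq_zero_iff F p] at h0
    have := Finset.mem_Icc.1 hj
    have := Nat.le_of_dvd (by omega) h0
    omega
  · intro i hi hij
    have := Finset.mem_Icc.1 hj
    have := Finset.mem_Icc.1 hi
    exact if_neg (by omega)

theorem iterate_mem {F g : Type*} [Field F] [AddCommGroup g] [Module F g] {α : g → g}
    {L : Submodule F g} (hLα : ∀ x ∈ L, α x ∈ L) {x : g} (hx : x ∈ L) (n : ℕ) : α^[n] x ∈ L :=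
  Set.MapsTo.iterate (s := (L : Set g)) hLα n hx

theorem adPow_mem {F g : Type*} [Field F] [AddCommGroup g] [Module F g] {br : g → g → g}
    {α : g → g} {L : Submodule F g} (hLα : ∀ x ∈ L, α x ∈ L)
    (hLbr : ∀ x ∈ L, ∀ y ∈ L, br x y ∈ L) {x z : g} (hx : x ∈ L) (hz : z ∈ L) (n : ℕ) :
    adPow br α x n z ∈ L := by
  induction n with
  | zero => exact hz
  | succ n ih => exact hLbr _ (iterate_mem hLα hx n) _ ih

/-- Let `(g, br, α, pm)` be a restricted Hom-Lie algebra, `L ⊆ g` a Hom-Lie subalgebra, and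
`pm1` a map sending `L` into `L`. Then `pm1` is a `p`-structure on `L` iff there is a
`p`-semilinear map `f` from `L` into the `α^(p-1)`-centralizer `C_g(L)` with
`pm1 = pm + f` on `L`. -/
theorem pStructure_iff_semilinear_correction {F g : Type*} [Field F]
    [AddCommGroup g] [Module F g]
    (p : ℕ) (hp : p.Prime) [CharP F p]
    (br : g → g → g) (α : g → g) (pm : g → g)
    (hHL : IsHomLie F br α) (hM : IsMult br α)
    (hps : IsPStructureOn F p br α Set.univ pm)
    (L : Submodule F g) (hLα : ∀ x ∈ L, α x ∈ L) (hLbr : ∀ x ∈ L, ∀ y ∈ L, br x y ∈ L)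
    (pm1 : g → g) (hpm1 : ∀ x ∈ L, pm1 x ∈ L) :
    IsPStructureOn F p br α (L : Set g) pm1 ↔
      ∃ f : g → g,
        (∀ x ∈ L, ∀ y ∈ L, ∀ k : F, f (k • x + y) = k ^ p • f x + f y) ∧
        (∀ x ∈ L, ∀ y ∈ L, br (f x) (α^[p - 1] y) = 0) ∧
        (∀ x ∈ L, pm1 x = pm x + f x) := by
  obtain ⟨-, h1, h2, h3⟩ := hps
  have br_add := hHL.add_left
  constructor
  · rintro ⟨-, k1, k2, k3⟩
    refine ⟨fun x => pm1 x - pm x, ?_, ?_, fun x _ => (add_sub_cancel (pm x) (pm1 x)).symm⟩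
    · intro x hx y hy k
      obtain ⟨s, -, hs, hsp⟩ := h3 (k • x) trivial y trivial
      obtain ⟨t, -, ht, htp⟩ := k3 (k • x) (L.smul_mem k hx) y hy
      have hst : ∀ i ∈ Finset.Icc 1 (p - 1), s i - t i = 0 :=
        coeff_eq_zero_of_forall_sum_eq_zero (F := F) hp fun c => by
          simp only [smul_sub, Finset.sum_sub_distrib, ← hs, ← ht, sub_self]
      have hsum := Finset.sum_congr rfl fun i hi => sub_eq_zero.1 (hst i hi)
      simp only [hsp, htp, hsum, h2 x trivial, k2 x hx, smul_sub]
      abel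
    · intro x hx y hy
      have h := br_add (pm1 x - pm x) (pm x) (α^[p - 1] y)
      rw [sub_add_cancel, k1 x hx y hy, h1 x trivial y trivial] at h
      exact right_eq_add.1 h
  · rintro ⟨f, hf, hfc, hfp⟩
    have f_zero : f 0 = 0 := by simpa using hf 0 L.zero_mem 0 L.zero_mem 1
    refine ⟨hpm1, ?_, ?_, ?_⟩
    · intro x hx y hy
      rw [hfp x hx, br_add, hfc x hx y hy, add_zero, h1 x trivial y trivial]
    · intro x hx k
      have hfk := hf x hx 0 L.zero_mem k
      rw [add_zero, f_zero, add_zero] at hfk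
      rw [hfp _ (L.smul_mem k hx), hfp x hx, h2 x trivial, hfk, smul_add]
    · intro x hx y hy
      obtain ⟨s, -, hs, hsp⟩ := h3 x trivial y trivial
      refine ⟨s, ?_, hs, ?_⟩
      · have hq := coeff_eq_zero_of_forall_sum_eq_zero (F := F) hp (s := fun i => L.mkQ (s i))
          fun c => by
            simp only [← map_smul, ← map_sum, ← hs]
            exact (Submodule.Quotient.mk_eq_zero L).2
              (adPow_mem hLα hLbr (L.add_mem (L.smul_mem c hx) hy) hx _)
        exact fun i hi => (Submodule.Quotient.mk_eq_zero L).1 (hq i hi)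
      · have hfa := hf x hx y hy 1
        rw [one_smul, one_pow, one_smul] at hfa
        rw [hfp _ (L.add_mem hx hy), hfp x hx, hfp y hy, hsp, hfa]
        abel

end HomLiePaper
end

section
/- Let (L,[.,.],α) be a multiplicative Hom-Lie algebra over a field F of prime characteristic p whose α^{p-1}-center is zero, i.e., C(L) = {x ∈ L | [x,α^{p-1}(y)] = 0 for all y ∈ L} = 0. Then L admits at most one p-structure: any two p-structures on (L,[.,.],α) are equal. -/
namespace HomLiePaper

/-- A multiplicative Hom-Lie algebra whose `α^(p-1)`-center is zero admits at most one
`p`-structure. -/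
theorem pStructure_unique_of_center_eq_bot {F L : Type*} [Field F]
    [AddCommGroup L] [Module F L]
    (p : ℕ) (hp : p.Prime) [CharP F p]
    (br : L → L → L) (α : L → L)
    (hHL : IsHomLie F br α) (hM : IsMult br α)
    (hC : ∀ x : L, (∀ y : L, br x (α^[p - 1] y) = 0) → x = 0)
    (pm1 pm2 : L → L)
    (h1 : IsPStructureOn F p br α Set.univ pm1)
    (h2 : IsPStructureOn F p br α Set.univ pm2) :
    pm1 = pm2 := by
  funext x
  refine sub_eq_zero.mp (hC _ fun y => ?_)
  have h := (h1.2.1 x trivial y trivial).trans (h2.2.1 x trivial y trivial).symm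
  rw [sub_eq_add_neg, hHL.add_left, ← neg_one_smul F (pm2 x), hHL.smul_left, h,
    neg_one_smul, add_neg_cancel]
end HomLiePaper
end

section
/- Let f : (L,[.,.]_L,α) → (L₁,[.,.]_{L₁},α₁) be a surjective morphism of multiplicative Hom-Lie algebras over a field F of prime characteristic p. If L is restrictable, then L₁ is restrictable. -/
namespace HomLiePaper

/-- A map intertwining brackets and twists intertwines the iterated adjoint operators. -/
lemma map_adPow {L L₁ : Type*} {br : L → L → L} {α : L → L} {br1 : L₁ → L₁ → L₁} {α₁ : L₁ → L₁}
    {f : L → L₁} (hfbr : ∀ x y : L, f (br x y) = br1 (f x) (f y))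
    (hfα : Function.Semiconj f α α₁) (x z : L) (n : ℕ) :
    f (adPow br α x n z) = adPow br1 α₁ (f x) n (f z) := by
  induction n with
  | zero => rfl
  | succ n ih => simp only [adPow, hfbr, ih, (hfα.iterate_right n).eq]

/-- A surjective morphism of multiplicative Hom-Lie algebras carries restrictability of the
source to the target. -/
theorem restrictable_of_surjective {F L L₁ : Type*} [Field F]
    [AddCommGroup L] [Module F L] [AddCommGroup L₁] [Module F L₁]
    (p : ℕ) (hp : p.Prime) [CharP F p]
    (br : L → L → L) (α : L → L)
    (br1 : L₁ → L₁ → L₁) (α₁ : L₁ → L₁)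
    (hHL : IsHomLie F br α) (hM : IsMult br α)
    (hHL1 : IsHomLie F br1 α₁) (hM1 : IsMult br1 α₁)
    (f : L → L₁) (hf : IsLinearMap F f) (hsurj : Function.Surjective f)
    (hfbr : ∀ x y : L, f (br x y) = br1 (f x) (f y)) (hfα : ∀ x : L, f (α x) = α₁ (f x))
    (hres : RestrictableOn p br α Set.univ) :
    RestrictableOn p br1 α₁ Set.univ := by
  have hα : Function.Semiconj f α α₁ := hfα
  intro x₁ _
  obtain ⟨x, rfl⟩ := hsurj x₁
  obtain ⟨y, -, hy⟩ := hres x (Set.mem_univ x)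
  refine ⟨f y, Set.mem_univ _, fun z₁ _ => ?_⟩
  obtain ⟨z, rfl⟩ := hsurj z₁
  rw [← map_adPow hfbr hα, hy z (Set.mem_univ z), hfbr, (hα.iterate_right (p - 1)).eq]
end HomLiePaper
end

section
/- Let L₁ and L₂ be Hom-Lie ideals of a multiplicative Hom-Lie algebra (L,[.,.],α) over a field F of prime characteristic p such that L = L₁ ⊕ L₂ (internal direct sum of subspaces). Then L is restrictable if and only if both L₁ and L₂ (each regarded as a multiplicative Hom-Lie algebra with the restricted bracket and the restriction of α) are restrictable. -/
namespace HomLiePaper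

section DirectSum

variable {F L : Type*} [Field F] [AddCommGroup L] [Module F L] {br : L → L → L} {α : L → L}
  {H K : Submodule F L}

theorem IsHomLie.iterate_add (hL : IsHomLie F br α) (n : ℕ) (x y : L) :
    α^[n] (x + y) = α^[n] x + α^[n] y :=
  iterate_map_add (IsLinearMap.mk' α hL.alpha_linear) n x y

theorem iterate_mem_s11 (hα : ∀ x ∈ H, α x ∈ H) {x : L} (hx : x ∈ H) (n : ℕ) : α^[n] x ∈ H :=
  Set.MapsTo.iterate (s := (H : Set L)) hα n hx

/-- Elements of two ideals with trivial intersection commute. -/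
theorem IsHomLie.br_eq_zero (hL : IsHomLie F br α)
    (hH : ∀ x ∈ H, ∀ y : L, br x y ∈ H) (hK : ∀ x ∈ K, ∀ y : L, br x y ∈ K)
    (hHK : Disjoint H K) {x y : L} (hx : x ∈ H) (hy : y ∈ K) : br x y = 0 := by
  refine Submodule.disjoint_def.mp hHK _ (hH x hx y) ?_
  rw [hL.skew]
  exact K.neg_mem (hK y hy x)

/-- The bracket of sums of elements of two independent ideals is computed componentwise. -/
theorem IsHomLie.br_add_add (hL : IsHomLie F br α)
    (hH : ∀ x ∈ H, ∀ y : L, br x y ∈ H) (hK : ∀ x ∈ K, ∀ y : L, br x y ∈ K)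
    (hHK : Disjoint H K) {x x' y y' : L} (hx : x ∈ H) (hx' : x' ∈ K) (hy : y ∈ H)
    (hy' : y' ∈ K) : br (x + x') (y + y') = br x y + br x' y' := by
  rw [hL.add_left, hL.add_right, hL.add_right, hL.br_eq_zero hH hK hHK hx hy',
    hL.br_eq_zero hK hH hHK.symm hx' hy, add_zero, zero_add]

theorem adPow_mem_s11 (hα : ∀ x ∈ H, α x ∈ H) (hH : ∀ x ∈ H, ∀ y : L, br x y ∈ H)
    {x z : L} (hx : x ∈ H) (hz : z ∈ H) (n : ℕ) : adPow br α x n z ∈ H := by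
  cases n with
  | zero => exact hz
  | succ n => exact hH _ (iterate_mem_s11 hα hx n) _

theorem IsHomLie.adPow_add_add (hL : IsHomLie F br α)
    (hHα : ∀ x ∈ H, α x ∈ H) (hH : ∀ x ∈ H, ∀ y : L, br x y ∈ H)
    (hKα : ∀ x ∈ K, α x ∈ K) (hK : ∀ x ∈ K, ∀ y : L, br x y ∈ K)
    (hHK : Disjoint H K) {x x' z z' : L} (hx : x ∈ H) (hx' : x' ∈ K) (hz : z ∈ H)
    (hz' : z' ∈ K) (n : ℕ) :
    adPow br α (x + x') n (z + z') = adPow br α x n z + adPow br α x' n z' := by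
  induction n with
  | zero => rfl
  | succ n ih =>
    simp only [adPow]
    rw [ih, hL.iterate_add]
    exact hL.br_add_add hH hK hHK (iterate_mem_s11 hHα hx n) (iterate_mem_s11 hKα hx' n)
      (adPow_mem_s11 hHα hH hx hz n) (adPow_mem_s11 hKα hK hx' hz' n)

/-- An ideal with a complementary ideal inherits restrictability. -/
theorem IsHomLie.restrictableOn_of_univ (hL : IsHomLie F br α) {p : ℕ}
    (hHα : ∀ x ∈ H, α x ∈ H) (hH : ∀ x ∈ H, ∀ y : L, br x y ∈ H)
    (hK : ∀ x ∈ K, ∀ y : L, br x y ∈ K) (hHK : IsCompl H K)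
    (h : RestrictableOn p br α Set.univ) : RestrictableOn p br α (H : Set L) := by
  intro x _
  obtain ⟨y, -, hy⟩ := h x trivial
  obtain ⟨u, hu, v, hv, rfl⟩ := Submodule.mem_sup.mp (hHK.sup_eq_top ▸ Submodule.mem_top (x := y))
  refine ⟨u, hu, fun z hz => ?_⟩
  rw [hy z trivial, hL.add_left,
    hL.br_eq_zero hK hH hHK.disjoint.symm hv (iterate_mem_s11 hHα hz _), add_zero]

/-- A direct sum of restrictable ideals is restrictable. -/
theorem IsHomLie.restrictableOn_univ (hL : IsHomLie F br α) {p : ℕ}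
    (hHα : ∀ x ∈ H, α x ∈ H) (hH : ∀ x ∈ H, ∀ y : L, br x y ∈ H)
    (hKα : ∀ x ∈ K, α x ∈ K) (hK : ∀ x ∈ K, ∀ y : L, br x y ∈ K) (hHK : IsCompl H K)
    (h : RestrictableOn p br α (H : Set L)) (h' : RestrictableOn p br α (K : Set L)) :
    RestrictableOn p br α Set.univ := by
  have split (w : L) : ∃ u ∈ H, ∃ v ∈ K, u + v = w :=
    Submodule.mem_sup.mp (hHK.sup_eq_top ▸ Submodule.mem_top)
  intro x _
  obtain ⟨x, hx, x', hx', rfl⟩ := split x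
  obtain ⟨y, hy, hxy⟩ := h x hx
  obtain ⟨y', hy', hxy'⟩ := h' x' hx'
  refine ⟨y + y', trivial, fun z _ => ?_⟩
  obtain ⟨z, hz, z', hz', rfl⟩ := split z
  rw [hL.adPow_add_add hHα hH hKα hK hHK.disjoint hx hx' hz hz', hxy z hz, hxy' z' hz',
    hL.iterate_add]
  exact (hL.br_add_add hH hK hHK.disjoint hy hy' (iterate_mem_s11 hHα hz _)
    (iterate_mem_s11 hKα hz' _)).symm

end DirectSum

/-- If `L = L₁ ⊕ L₂` is the internal direct sum of two Hom-Lie ideals, then `L` is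
restrictable iff both `L₁` and `L₂` are restrictable. -/
theorem restrictable_directSum_iff {F L : Type*} [Field F]
    [AddCommGroup L] [Module F L]
    (p : ℕ) (hp : p.Prime) [CharP F p]
    (br : L → L → L) (α : L → L)
    (hHL : IsHomLie F br α) (hM : IsMult br α)
    (L₁ L₂ : Submodule F L)
    (h1α : ∀ x ∈ L₁, α x ∈ L₁) (h1br : ∀ x ∈ L₁, ∀ y : L, br x y ∈ L₁)
    (h2α : ∀ x ∈ L₂, α x ∈ L₂) (h2br : ∀ x ∈ L₂, ∀ y : L, br x y ∈ L₂)
    (hsum : L₁ ⊔ L₂ = ⊤) (hinter : L₁ ⊓ L₂ = ⊥) :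
    RestrictableOn p br α Set.univ ↔
      (RestrictableOn p br α (L₁ : Set L) ∧ RestrictableOn p br α (L₂ : Set L)) := by
  have hc : IsCompl L₁ L₂ := ⟨disjoint_iff.mpr hinter, codisjoint_iff.mpr hsum⟩
  exact ⟨fun h => ⟨hHL.restrictableOn_of_univ h1α h1br h2br hc h,
      hHL.restrictableOn_of_univ h2α h2br h1br hc.symm h⟩,
    fun h => hHL.restrictableOn_univ h1α h1br h2α h2br hc h.1 h.2⟩

end HomLiePaper
end

section
/- Let (L,[.,.],α) be a regular multiplicative Hom-Lie algebra over a field F of prime characteristic p with L = [L,L] + C(L), and let I ⊆ C(L) be a Hom-Lie ideal of L. Then L is restrictable if and only if the quotient Hom-Lie algebra L/I is restrictable. -/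
namespace HomLiePaper

open TensorProduct in
/-- In characteristic `p`, the `p`-th power of a derivation of a bilinear product is again a
derivation. -/
lemma pow_prime_apply_of_derivation {F L : Type*} [Field F] [AddCommGroup L] [Module F L]
    {p : ℕ} (hp : p.Prime) [CharP F p] (B : L →ₗ[F] L →ₗ[F] L) (D : Module.End F L)
    (hD : ∀ u v, D (B u v) = B (D u) v + B u (D v)) (u v : L) :
    (D ^ p) (B u v) = B ((D ^ p) u) v + B u ((D ^ p) v) := by
  let R : Module.End F (L ⊗[F] L) := LinearMap.rTensor L D
  let S : Module.End F (L ⊗[F] L) := LinearMap.lTensor L D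
  have hcomm : Commute R S := by
    refine TensorProduct.ext' fun a b => ?_
    simp [R, S]
  have hlift : ∀ (n : ℕ) (t : L ⊗[F] L),
      (D ^ n) (TensorProduct.lift B t) = TensorProduct.lift B (((R + S) ^ n) t) := by
    have hone : ∀ t : L ⊗[F] L, D (TensorProduct.lift B t) =
        TensorProduct.lift B ((R + S) t) := fun t => by
      induction t with
      | zero => simp
      | tmul a b => simp [R, S, hD]
      | add a b ha hb => simp only [map_add, ha, hb]
    intro n
    induction n with
    | zero => simp
    | succ n ih => intro t; simp only [pow_succ, Module.End.mul_apply, hone, ih]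
  obtain ⟨r, hr⟩ := hcomm.exists_add_pow_prime_eq hp
  have hpr : ∀ t : L, p • t = 0 := fun t => by
    rw [← Nat.cast_smul_eq_nsmul F, CharP.cast_eq_zero, zero_smul]
  have hRp : R ^ p = LinearMap.rTensor L (D ^ p) := LinearMap.rTensor_pow D p
  have hSp : S ^ p = LinearMap.lTensor L (D ^ p) := LinearMap.lTensor_pow D p
  have h := hlift p (u ⊗ₜ v)
  rw [hr] at h
  simpa [hRp, hSp, hpr] using h

/-- The twist of a regular Hom-Lie algebra as a linear equivalence. -/
noncomputable def IsHomLie.twistEquiv {F L : Type*} [Field F] [AddCommGroup L] [Module F L]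
    {br : L → L → L} {α : L → L} (h : IsHomLie F br α) (hα : Function.Bijective α) :
    L ≃ₗ[F] L :=
  LinearEquiv.ofBijective (h.alpha_linear.mk' α) hα

/-- The untwisted product `α⁻¹ [x, y]` of a regular Hom-Lie algebra. -/
noncomputable def IsHomLie.untwist {F L : Type*} [Field F] [AddCommGroup L] [Module F L]
    {br : L → L → L} {α : L → L} (h : IsHomLie F br α) (hα : Function.Bijective α) :
    L →ₗ[F] L →ₗ[F] L :=
  (LinearMap.mk₂ F br h.add_left h.smul_left h.add_right h.smul_right).compr₂
    (h.twistEquiv hα).symm.toLinearMap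

lemma IsMult.iterate {L : Type*} {br : L → L → L} {α : L → L} (hM : IsMult br α) (n : ℕ) (x y : L) :
    α^[n] (br x y) = br (α^[n] x) (α^[n] y) := by
  induction n generalizing x y with
  | zero => rfl
  | succ n ih => simp only [Function.iterate_succ_apply, hM x y, ih]

section Untwist

variable {F L : Type*} [Field F] [AddCommGroup L] [Module F L] {br : L → L → L} {α : L → L}

lemma IsHomLie.apply_untwist (h : IsHomLie F br α) (hα : Function.Bijective α) (x y : L) :
    α (h.untwist hα x y) = br x y :=
  (h.twistEquiv hα).apply_symm_apply (br x y)

lemma IsHomLie.untwist_leibniz (h : IsHomLie F br α) (hM : IsMult br α)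
    (hα : Function.Bijective α) (x u v : L) :
    h.untwist hα x (h.untwist hα u v) =
      h.untwist hα (h.untwist hα x u) v + h.untwist hα u (h.untwist hα x v) := by
  apply hα.1
  apply hα.1
  simp only [h.alpha_linear.map_add, h.apply_untwist, hM _ _]
  have hJ := h.jacobi x u v
  have hneg : br (α u) (br v x) = - br (α u) (br x v) := by
    rw [h.skew v x, ← neg_one_smul F (br x v), h.smul_right, neg_one_smul]
  rw [hneg, h.skew (α v)] at hJ
  rw [← sub_eq_zero, ← hJ]
  abel

lemma IsHomLie.adPow_eq_untwist_pow (h : IsHomLie F br α) (hM : IsMult br α)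
    (hα : Function.Bijective α) (x z : L) (n : ℕ) :
    adPow br α x n z = α^[n] ((h.untwist hα x ^ n) z) := by
  induction n with
  | zero => rfl
  | succ n ih =>
    simp only [adPow]
    rw [ih, ← hM.iterate, Function.iterate_succ_apply, pow_succ', Module.End.mul_apply,
      h.apply_untwist]

end Untwist

lemma iterate_mk {F L : Type*} [Field F] [AddCommGroup L] [Module F L] {I : Submodule F L}
    {α : L → L} {αQ : L ⧸ I → L ⧸ I}
    (hαQ : ∀ x : L, αQ (Submodule.Quotient.mk x) = Submodule.Quotient.mk (α x))
    (n : ℕ) (x : L) :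
    αQ^[n] (Submodule.Quotient.mk x) = Submodule.Quotient.mk (α^[n] x) :=
  ((Function.Semiconj.iterate_right (f := Submodule.Quotient.mk) fun a => (hαQ a).symm) n x).symm

lemma adPow_mk {F L : Type*} [Field F] [AddCommGroup L] [Module F L] {I : Submodule F L}
    {br : L → L → L} {α : L → L} {brQ : L ⧸ I → L ⧸ I → L ⧸ I} {αQ : L ⧸ I → L ⧸ I}
    (hbrQ : ∀ x y : L, brQ (Submodule.Quotient.mk x) (Submodule.Quotient.mk y)
        = Submodule.Quotient.mk (br x y))
    (hαQ : ∀ x : L, αQ (Submodule.Quotient.mk x) = Submodule.Quotient.mk (α x))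
    (x z : L) (n : ℕ) :
    adPow brQ αQ (Submodule.Quotient.mk x) n (Submodule.Quotient.mk z)
      = Submodule.Quotient.mk (adPow br α x n z) := by
  induction n with
  | zero => rfl
  | succ n ih => simp only [adPow, ih, iterate_mk hαQ, hbrQ]

/-- For a regular multiplicative Hom-Lie algebra with `L = [L,L] + C(L)` and a Hom-Lie ideal
`I ⊆ C(L)`, the algebra `L` is restrictable iff the quotient `L/I` (with the induced
bracket and twist) is restrictable. -/
theorem restrictable_iff_quotient_restrictable {F L : Type*} [Field F]
    [AddCommGroup L] [Module F L]
    (p : ℕ) (hp : p.Prime) [CharP F p]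
    (br : L → L → L) (α : L → L)
    (hHL : IsHomLie F br α) (hM : IsMult br α) (hreg : Function.Bijective α)
    (hLC : Submodule.span F
        ({z : L | ∃ x y : L, z = br x y} ∪ {x : L | ∀ y : L, br x (α^[p - 1] y) = 0}) = ⊤)
    (I : Submodule F L)
    (hIC : ∀ x ∈ I, ∀ y : L, br x (α^[p - 1] y) = 0)
    (hIα : ∀ x ∈ I, α x ∈ I) (hIbr : ∀ x ∈ I, ∀ y : L, br x y ∈ I)
    (brQ : (L ⧸ I) → (L ⧸ I) → (L ⧸ I)) (αQ : (L ⧸ I) → (L ⧸ I))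
    (hbrQ : ∀ x y : L, brQ (Submodule.Quotient.mk x) (Submodule.Quotient.mk y)
        = Submodule.Quotient.mk (br x y))
    (hαQ : ∀ x : L, αQ (Submodule.Quotient.mk x) = Submodule.Quotient.mk (α x)) :
    RestrictableOn p br α Set.univ ↔ RestrictableOn p brQ αQ Set.univ := by
  have hinj : ∀ n, Function.Injective α^[n] := hreg.1.iterate
  have hsurj : ∀ n, Function.Surjective α^[n] := hreg.2.iterate
  constructor
  · intro hR x _
    obtain ⟨x, rfl⟩ := Submodule.Quotient.mk_surjective I x
    obtain ⟨y, -, hy⟩ := hR x trivial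
    refine ⟨Submodule.Quotient.mk y, trivial, fun z _ => ?_⟩
    obtain ⟨z, rfl⟩ := Submodule.Quotient.mk_surjective I z
    rw [adPow_mk hbrQ hαQ, iterate_mk hαQ, hbrQ, hy z trivial]
  intro hR x _
  obtain ⟨y, -, hy⟩ := hR (Submodule.Quotient.mk x) trivial
  obtain ⟨y, rfl⟩ := Submodule.Quotient.mk_surjective I y
  obtain ⟨w, rfl⟩ := hsurj (p - 1) y
  set B := hHL.untwist hreg
  have hBα : ∀ a b, α (B a b) = br a b := hHL.apply_untwist hreg
  have h0 : α 0 = 0 := hHL.alpha_linear.map_zero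
  have hbr0 : ∀ a b, br a b = 0 → B a b = 0 := fun a b hab =>
    hreg.1 (by rw [hBα, hab, h0])
  have hskew0 : ∀ a b, br a b = 0 → br b a = 0 := fun a b hab => by
    rw [hHL.skew, hab, neg_zero]
  have hcentral : ∀ a, (∀ b, br a (α^[p - 1] b) = 0) → ∀ b, br a b = 0 := fun a ha b => by
    obtain ⟨b, rfl⟩ := hsurj (p - 1) b
    exact ha b
  have hpα : ∀ a, α^[p] a = α^[p - 1] (α a) := fun a => by
    rw [← Function.iterate_succ_apply, Nat.succ_eq_add_one, Nat.sub_add_cancel hp.one_le]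
  have hbrw : ∀ z, br (α^[p - 1] w) (α^[p - 1] z) = α^[p] (B w z) := fun z => by
    rw [hpα, hBα, hM.iterate]
  have hmap_sub : ∀ n a b, α^[n] (a - b) = α^[n] a - α^[n] b := fun n a b =>
    iterate_map_sub (hHL.alpha_linear.mk' α) n a b
  have hmap_zero : ∀ n, α^[n] 0 = 0 := fun n => iterate_map_zero (hHL.alpha_linear.mk' α) n
  let E : Module.End F L := B x ^ p - B w
  have hEI : ∀ z, α^[p] (E z) ∈ I := fun z => by
    have hz := hy (Submodule.Quotient.mk z) trivial
    rw [adPow_mk hbrQ hαQ, iterate_mk hαQ, hbrQ, Submodule.Quotient.eq,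
      hHL.adPow_eq_untwist_pow hM hreg, hbrw, ← hmap_sub] at hz
    exact hz
  have hEZ : ∀ z b, br (E z) b = 0 := fun z b => hinj p (by
    rw [hM.iterate, hmap_zero]
    exact hcentral _ (hIC _ (hEI z)) _)
  have hEder : ∀ u v, E (B u v) = B (E u) v + B u (E v) := fun u v => by
    simp only [E, LinearMap.sub_apply, map_sub]
    rw [pow_prime_apply_of_derivation hp B (B x) (hHL.untwist_leibniz hM hreg x),
      hHL.untwist_leibniz hM hreg w]
    abel
  have hE : E = 0 := by
    refine LinearMap.ext_on hLC ?_
    rintro z (⟨a, b, rfl⟩ | hz)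
    · have hab : br a b = B (α a) (α b) := hreg.1 (by rw [hBα, hM])
      rw [hab, hEder, hbr0 _ _ (hEZ _ _), hbr0 _ _ (hskew0 _ _ (hEZ _ _)), add_zero]
      rfl
    · have hxz : ∀ a, B a z = 0 := fun a => hbr0 _ _ (hskew0 _ _ (hcentral z hz a))
      obtain ⟨m, hm⟩ := Nat.exists_eq_succ_of_ne_zero hp.ne_zero
      simp [E, hm, pow_succ, hxz]
  refine ⟨α^[p - 1] w, trivial, fun z _ => ?_⟩
  have hz : (B x ^ p) z - B w z = 0 := LinearMap.congr_fun hE z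
  rw [hHL.adPow_eq_untwist_pow hM hreg, hbrw, sub_eq_zero.1 hz]
end HomLiePaper
end
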